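/- Let Λ be a ring with 1 whose underlying additive group is a free ℤ-module of finite positive rank and such that Λ⊗ℚ is a semisimple ℚ-algebra, and let M be a free abelian group of finite positive rank equipped with a right Λ-module structure which is locally free of rank 1 (i.e., for every prime ℓ the right Λ⊗ℤ_ℓ-module M⊗ℤ_ℓ is free of rank 1). Then the right Λ⊗ℚ-module M⊗ℚ is free of rank 1. -/

import Mathlib

/-!
STATEMENT 0. A right module over a ring `Λ` is formalized as a module over the opposite
ring `Λᵐᵒᵖ`; accordingly, a right module over the base change `Λ ⊗ ℤ_ℓ` is formalized as
a module over `Λᵐᵒᵖ ⊗[ℤ] ℤ_[ℓ]`.  The module structure of `Λᵐᵒᵖ ⊗[ℤ] S` on `M ⊗[ℤ] S`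
(for a commutative ring `S`) is the canonical one: `Λᵐᵒᵖ` acts on the first factor and
`S` by multiplication on the second factor; it is constructed below.
"Free of rank 1" is expressed as the existence of a basis indexed by `Fin 1`.
-/

open scoped TensorProduct

namespace AlmostIso

variable (A S M : Type*) [Ring A] [CommRing S] [AddCommGroup M] [Module A M]

/-- Multiplication by elements of `S` on the second factor of `M ⊗[ℤ] S`,
as a ring homomorphism into `ℤ`-linear endomorphisms. -/
noncomputable def rmulHom : S →+* Module.End ℤ (M ⊗[ℤ] S) where
  toFun s := LinearMap.lTensor M (LinearMap.mulLeft ℤ s)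
  map_one' := by
    rw [LinearMap.mulLeft_one, LinearMap.lTensor_id]; rfl
  map_mul' s t := by
    rw [LinearMap.mulLeft_mul, LinearMap.lTensor_comp]; rfl
  map_zero' := by
    rw [LinearMap.mulLeft_zero_eq_zero, LinearMap.lTensor_zero]; rfl
  map_add' s t := by
    have h : LinearMap.mulLeft ℤ (s + t) = LinearMap.mulLeft ℤ s + LinearMap.mulLeft ℤ t := by
      ext x; simp [add_mul]
    rw [h, LinearMap.lTensor_add]; rfl

theorem commute_lsmul_rmul (a : A) (s : S) :
    Commute ((Algebra.lsmul ℤ ℤ (M ⊗[ℤ] S) : A →ₐ[ℤ] Module.End ℤ (M ⊗[ℤ] S)) a)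
      ((rmulHom S M).toIntAlgHom s) := by
  refine LinearMap.ext fun x => ?_
  induction x using TensorProduct.induction_on with
  | zero => simp [Module.End.mul_apply]
  | tmul m t =>
      exact TensorProduct.smul_tmul' a m (s * t)
  | add x y hx hy =>
      simp only [Module.End.mul_apply, map_add] at hx hy ⊢
      rw [hx, hy]

/-- The base change `M ⊗[ℤ] S` of a module `M` over `A` is a module over
`A ⊗[ℤ] S`: `A` acts on the first factor and `S` by multiplication on the second. -/
noncomputable instance bcModule : Module (A ⊗[ℤ] S) (M ⊗[ℤ] S) :=
  Module.compHom _
    (Algebra.TensorProduct.lift (Algebra.lsmul ℤ ℤ (M ⊗[ℤ] S))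
      (rmulHom S M).toIntAlgHom (commute_lsmul_rmul A S M)).toRingHom

end AlmostIso


namespace AlmostIso

section Coordinates

variable {A S M ι κ : Type*} [Ring A] [CommRing S] [AddCommGroup M] [Module A M]
  [Fintype κ]

/-- The matrix, in coordinates, of the map `r ↦ r • y` where `y` has coordinates `v`. -/
noncomputable def smulMatrix (b : Module.Basis ι ℤ A) (c : Module.Basis κ ℤ M) (v : κ → S) : Matrix κ ι S :=
  fun k i => ∑ j, v j * (c.repr (b i • c j) k : S)

theorem smulMatrix_map {T : Type*} [CommRing T] (f : S →+* T) (b : Module.Basis ι ℤ A)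
    (c : Module.Basis κ ℤ M) (v : κ → S) :
    (smulMatrix b c v).map f = smulMatrix b c (f ∘ v) := by
  ext k i
  simp [smulMatrix]

variable [DecidableEq κ]

theorem bcModule_tmul_smul_tmul (a : A) (s : S) (m : M) (t : S) :
    (a ⊗ₜ[ℤ] s : A ⊗[ℤ] S) • (m ⊗ₜ[ℤ] t : M ⊗[ℤ] S) = (a • m) ⊗ₜ[ℤ] (s * t) := rfl

/-- The coordinates on `M ⊗[ℤ] S` induced by a `ℤ`-basis of `M`. -/
noncomputable def bcCoord (S : Type*) [CommRing S] (c : Module.Basis κ ℤ M) :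
    M ⊗[ℤ] S ≃ₗ[ℤ] (κ → S) :=
  (TensorProduct.congr c.equivFun (LinearEquiv.refl ℤ S)).trans
    ((TensorProduct.comm ℤ (κ → ℤ) S).trans (TensorProduct.piScalarRight ℤ ℤ S κ))

theorem bcCoord_tmul (c : Module.Basis κ ℤ M) (m : M) (t : S) (k : κ) :
    bcCoord S c (m ⊗ₜ[ℤ] t) k = (c.repr m k : S) * t := by
  change c.equivFun m k • t = _
  rw [Module.Basis.equivFun_apply, zsmul_eq_mul]

variable [Fintype ι] [DecidableEq ι]

theorem bcCoord_smul (b : Module.Basis ι ℤ A) (c : Module.Basis κ ℤ M)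
    (r : A ⊗[ℤ] S) (y : M ⊗[ℤ] S) :
    bcCoord S c (r • y) = (smulMatrix b c (bcCoord S c y)).mulVec (bcCoord S b r) := by
  have smulMatrix_add (v w : κ → S) :
      smulMatrix b c (v + w) = smulMatrix b c v + smulMatrix b c w := by
    ext k i
    simp [smulMatrix, add_mul, Finset.sum_add_distrib]
  induction r using TensorProduct.induction_on with
  | zero =>
    refine (congrArg (bcCoord S c) (zero_smul (A ⊗[ℤ] S) y)).trans ?_
    rw [map_zero, map_zero, Matrix.mulVec_zero]
  | add r₁ r₂ h₁ h₂ => rw [add_smul, map_add, map_add, h₁, h₂, Matrix.mulVec_add]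
  | tmul a s =>
    induction y using TensorProduct.induction_on with
    | zero => ext; simp [smulMatrix, Matrix.mulVec, dotProduct]
    | add y₁ y₂ h₁ h₂ =>
      rw [smul_add, map_add, map_add, h₁, h₂, smulMatrix_add, Matrix.add_mulVec]
    | tmul m t =>
      ext k
      have expand : c.repr (a • m) k =
          ∑ i, ∑ j, b.repr a i * (c.repr m j * c.repr (b i • c j) k) := by
        have comm_smul (x : A) (n : ℤ) (z : M) : x • n • z = n • x • z :=
          (smul_comm n x z).symm
        conv_lhs => rw [← b.sum_repr a, ← c.sum_repr m]
        simp only [Finset.sum_smul, Finset.smul_sum, comm_smul, smul_assoc, map_sum, map_zsmul,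
          Finsupp.finsetSum_apply, Finsupp.smul_apply, smul_eq_mul]
        rw [Finset.sum_comm]
        exact Finset.sum_congr rfl fun i _ => Finset.sum_congr rfl fun j _ => mul_left_comm ..
      rw [bcModule_tmul_smul_tmul, bcCoord_tmul, expand]
      simp only [smulMatrix, Matrix.mulVec, dotProduct, bcCoord_tmul, Finset.sum_mul,
        Int.cast_sum, Int.cast_mul]
      refine Finset.sum_congr rfl fun i _ => Finset.sum_congr rfl fun j _ => ?_
      ring

theorem bijective_smul_iff_bijective_mulVec (b : Module.Basis ι ℤ A) (c : Module.Basis κ ℤ M)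
    (y : M ⊗[ℤ] S) :
    Function.Bijective (fun r : A ⊗[ℤ] S => r • y) ↔
      Function.Bijective (smulMatrix b c (bcCoord S c y)).mulVec := by
  have h : bcCoord S c ∘ (fun r : A ⊗[ℤ] S => r • y) =
      (smulMatrix b c (bcCoord S c y)).mulVec ∘ bcCoord S b :=
    funext fun r => bcCoord_smul b c r y
  rw [← (bcCoord S c).bijective.of_comp_iff', h, (bcCoord S b).bijective.of_comp_iff]

theorem exists_det_smulMatrix_int_ne_zero (b : Module.Basis κ ℤ A) (c : Module.Basis κ ℤ M)
    (v : κ → S) (hv : (smulMatrix b c v).det ≠ 0) :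
    ∃ x : κ → ℤ, (smulMatrix b c x).det ≠ 0 := by
  by_contra! h
  have det_generic : (smulMatrix b c (MvPolynomial.X : κ → MvPolynomial κ ℤ)).det = 0 := by
    refine MvPolynomial.funext fun x => ?_
    rw [RingHom.map_det, RingHom.mapMatrix_apply, smulMatrix_map, map_zero, ← h x]
    congr 2
    ext j
    simp
  apply hv
  have := congrArg (MvPolynomial.eval₂Hom (Int.castRingHom S) v) det_generic
  rw [RingHom.map_det, RingHom.mapMatrix_apply, smulMatrix_map, map_zero] at this
  rw [← this]
  congr 2
  ext j
  simp

end Coordinates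

theorem nonempty_basis_fin_one_iff {R N : Type*} [Ring R] [AddCommGroup N] [Module R N] :
    Nonempty (Module.Basis (Fin 1) R N) ↔ ∃ y : N, Function.Bijective (fun r : R => r • y) := by
  constructor
  · rintro ⟨β⟩
    refine ⟨β 0, ?_⟩
    convert ((LinearEquiv.funUnique (Fin 1) R R).symm.trans β.equivFun.symm).bijective using 1
    ext r
    simp [Module.Basis.equivFun_symm_apply]
  · rintro ⟨y, hy⟩
    exact ⟨.ofEquivFun ((LinearEquiv.ofBijective (LinearMap.toSpanSingleton R N y) hy).symm.trans
      (LinearEquiv.funUnique (Fin 1) R R).symm)⟩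

/-- Being free of rank one descends from `S` to `ℚ` for any nontrivial `S`. -/
theorem nonempty_basis_rat_of_nonempty_basis {A S M : Type*} [Ring A] [CommRing S] [Nontrivial S]
    [AddCommGroup M] [Module A M] [Module.Free ℤ A] [Module.Finite ℤ A]
    [Module.Free ℤ M] [Module.Finite ℤ M]
    (h : Nonempty (Module.Basis (Fin 1) (A ⊗[ℤ] S) (M ⊗[ℤ] S))) :
    Nonempty (Module.Basis (Fin 1) (A ⊗[ℤ] ℚ) (M ⊗[ℤ] ℚ)) := by
  obtain ⟨y, hy⟩ := nonempty_basis_fin_one_iff.mp h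
  let c := Module.finBasis ℤ M
  let b' := Module.finBasis ℤ A
  have hy' := (bijective_smul_iff_bijective_mulVec b' c y).mp hy
  have rank_eq : Module.finrank ℤ A = Module.finrank ℤ M := by
    simpa using (LinearEquiv.ofBijective (Matrix.mulVecLin _) hy').finrank_eq
  let b := b'.reindex (finCongr rank_eq)
  have hb := (bijective_smul_iff_bijective_mulVec b c y).mp hy
  have det_ne : (smulMatrix b c (bcCoord S c y)).det ≠ 0 :=
    ((Matrix.isUnit_iff_isUnit_det _).mp
      (Matrix.mulVec_surjective_iff_isUnit.mp hb.surjective)).ne_zero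
  obtain ⟨x, hx⟩ := exists_det_smulMatrix_int_ne_zero b c _ det_ne
  refine nonempty_basis_fin_one_iff.mpr
    ⟨(bcCoord ℚ c).symm (Int.castRingHom ℚ ∘ x), (bijective_smul_iff_bijective_mulVec b c _).mpr ?_⟩
  have unit : IsUnit (smulMatrix b c (Int.castRingHom ℚ ∘ x)) := by
    rw [Matrix.isUnit_iff_isUnit_det, ← smulMatrix_map, ← RingHom.mapMatrix_apply,
      ← RingHom.map_det, isUnit_iff_ne_zero]
    simpa using hx
  rw [LinearEquiv.apply_symm_apply]
  exact ⟨Matrix.mulVec_injective_of_isUnit unit, Matrix.mulVec_surjective_iff_isUnit.mpr unit⟩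

end AlmostIso

open AlmostIso in
/-- Let `Λ` be a ring whose underlying additive group is a free `ℤ`-module of finite
positive rank, such that `Λ ⊗ ℚ` is a semisimple `ℚ`-algebra, and let `M` be a free
abelian group of finite positive rank with a right `Λ`-module structure which is locally
free of rank `1` (for every prime `ℓ` the right `Λ ⊗ ℤ_ℓ`-module `M ⊗ ℤ_ℓ` is free of
rank `1`).  Then the right `Λ ⊗ ℚ`-module `M ⊗ ℚ` is free of rank `1`. -/
theorem rat_base_change_free_of_rank_one_of_locally_free_rank_one
    (Λ M : Type) [Ring Λ]
    [Module.Free ℤ Λ] [Module.Finite ℤ Λ] (hΛrank : 0 < Module.finrank ℤ Λ)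
    [IsSemisimpleRing (Λ ⊗[ℤ] ℚ)]
    [AddCommGroup M] [Module Λᵐᵒᵖ M]
    [Module.Free ℤ M] [Module.Finite ℤ M] (hMrank : 0 < Module.finrank ℤ M)
    (hloc : ∀ (ℓ : ℕ) [Fact ℓ.Prime],
      Nonempty (Module.Basis (Fin 1) (Λᵐᵒᵖ ⊗[ℤ] ℤ_[ℓ]) (M ⊗[ℤ] ℤ_[ℓ]))) :
    Nonempty (Module.Basis (Fin 1) (Λᵐᵒᵖ ⊗[ℤ] ℚ) (M ⊗[ℤ] ℚ)) := by
  have : Module.Free ℤ Λᵐᵒᵖ := .of_equiv (MulOpposite.opLinearEquiv ℤ)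
  have : Module.Finite ℤ Λᵐᵒᵖ := .equiv (MulOpposite.opLinearEquiv ℤ)
  have : Fact (Nat.Prime 2) := ⟨Nat.prime_two⟩
  exact nonempty_basis_rat_of_nonempty_basis (hloc 2)
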